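/- Define ψ(q, t) := Σ_{j∈ℤ} (𝓗 ik')(q − j) · w(j − q − t). Then: (i) ψ(q + 1, t) = ψ(q, t) for all q, t ∈ ℝ; (ii) there exists C > 0 such that |ψ(q, t)| ≤ C/(1 + t²) for all q, t ∈ ℝ; and (iii) ∫_ℝ ψ(q, t) dt = 0 for every q ∈ ℝ. -/

import Mathlib

open MeasureTheory Filter Topology

/-- The kernel `1 / r` cut off at `|r| ≤ δ`. -/
noncomputable def truncInv (δ r : ℝ) : ℝ := if δ < |r| then 1 / r else 0

lemma truncInv_neg (δ r : ℝ) : truncInv δ (-r) = -truncInv δ r := by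
  unfold truncInv
  rw [abs_neg]
  split_ifs
  · rw [div_neg]
  · simp

lemma abs_truncInv_le {δ : ℝ} (r : ℝ) : |truncInv δ r| ≤ 1 / |r| := by
  unfold truncInv
  split_ifs
  · rw [abs_div, abs_one]
  · simp

lemma abs_truncInv_le_of_pos {δ : ℝ} (hδ : 0 < δ) (r : ℝ) : |truncInv δ r| ≤ 1 / δ := by
  unfold truncInv
  split_ifs with h
  · rw [abs_div, abs_one]
    exact one_div_le_one_div_of_le hδ h.le
  · simpa using hδ.le

lemma measurable_truncInv (δ : ℝ) : Measurable (truncInv δ) := by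
  unfold truncInv
  exact Measurable.ite (measurableSet_lt measurable_const (by fun_prop)) (by fun_prop)
    measurable_const

lemma integrable_indicator_Icc_const (a b c : ℝ) :
    Integrable ((Set.Icc a b).indicator fun _ => c) :=
  (integrable_indicator_iff measurableSet_Icc).2 (integrableOn_const measure_Icc_lt_top.ne)

lemma integrable_mul_truncInv {g : ℝ → ℝ} (hg : Integrable g) {δ : ℝ} (hδ : 0 < δ) :
    Integrable fun r => g r * truncInv δ r :=
  hg.mul_bdd (c := 1 / δ) (measurable_truncInv δ).aestronglyMeasurable
    (ae_of_all _ fun r => abs_truncInv_le_of_pos hδ r)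

lemma setIntegral_div_eq_integral_truncInv (g : ℝ → ℝ) (x δ : ℝ) :
    ∫ s in {s : ℝ | δ < |x - s|}, g s / (x - s) = ∫ r, g (x - r) * truncInv δ r := by
  have hm : MeasurableSet {s : ℝ | δ < |x - s|} :=
    measurableSet_lt measurable_const (by fun_prop)
  rw [← integral_indicator hm,
    ← integral_sub_left_eq_self (fun r => g (x - r) * truncInv δ r) volume x]
  congr 1
  ext s
  simp only [Set.indicator, Set.mem_ofPred_eq, truncInv, sub_sub_cancel]
  split_ifs
  · ring
  · simp

/-- Symmetrization bound for truncated Hilbert integrals of Lipschitz functions. -/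
lemma abs_integral_truncInv_le_of_lipschitz {g : ℝ → ℝ} {L R : ℝ} (hg : Integrable g)
    (hR : 0 ≤ R) (hsupp : ∀ x, R < |x| → g x = 0) (hL : ∀ x y, |g x - g y| ≤ L * |x - y|)
    (x : ℝ) {δ : ℝ} (hδ : 0 < δ) :
    |∫ r, g (x - r) * truncInv δ r| ≤ 2 * L * (|x| + R) := by
  have hL0 : 0 ≤ L := by simpa using (abs_nonneg _).trans (hL 1 0)
  have hT : 0 ≤ |x| + R := by positivity
  have h1 : Integrable fun r => g (x - r) * truncInv δ r :=
    integrable_mul_truncInv (hg.comp_sub_left x) hδ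
  have h2 : Integrable fun r => g (x + r) * truncInv δ r :=
    integrable_mul_truncInv (hg.comp_add_left x) hδ
  have h3 : ∫ r, g (x - r) * truncInv δ r = -∫ r, g (x + r) * truncInv δ r := by
    rw [← integral_neg_eq_self, ← integral_neg]
    simp [truncInv_neg]
  have h4 : 2 * ∫ r, g (x - r) * truncInv δ r =
      ∫ r, (g (x - r) * truncInv δ r - g (x + r) * truncInv δ r) := by
    rw [integral_sub h1 h2]
    linarith
  have h5 : ‖∫ r, (g (x - r) * truncInv δ r - g (x + r) * truncInv δ r)‖ ≤
      ∫ r, (Set.Icc (-(|x| + R)) (|x| + R)).indicator (fun _ => 2 * L) r := by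
    refine norm_integral_le_of_norm_le (integrable_indicator_Icc_const _ _ _)
      (ae_of_all _ fun r => ?_)
    · rw [← sub_mul, Real.norm_eq_abs, abs_mul, Set.indicator_apply]
      have hmem : r ∈ Set.Icc (-(|x| + R)) (|x| + R) ↔ |r| ≤ |x| + R := abs_le.symm
      split_ifs with h
      · rw [hmem] at h
        have ha := hL (x - r) (x + r)
        have hb : |x - r - (x + r)| = 2 * |r| := by
          rw [show x - r - (x + r) = -(2 * r) by ring, abs_neg, abs_mul, abs_two]
        rw [hb] at ha
        calc |g (x - r) - g (x + r)| * |truncInv δ r| ≤ (L * (2 * |r|)) * (1 / |r|) := by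
              gcongr
              exact abs_truncInv_le r
          _ = 2 * L * (|r| / |r|) := by ring
          _ ≤ 2 * L * 1 := by
              gcongr
              exact div_self_le_one _
          _ = 2 * L := mul_one _
      · rw [hmem, not_le] at h
        have e1 := abs_sub_abs_le_abs_sub r x
        rw [abs_sub_comm] at e1
        have e2 := abs_sub_abs_le_abs_sub r (-x)
        rw [abs_neg, sub_neg_eq_add, add_comm r x] at e2
        rw [hsupp (x - r) (by linarith), hsupp (x + r) (by linarith)]
        simp
  rw [← h4, integral_indicator measurableSet_Icc, setIntegral_const, Real.norm_eq_abs, abs_mul,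
    abs_two, Real.volume_real_Icc_of_le (by linarith), smul_eq_mul] at h5
  linarith

/-- Decay of truncated Hilbert integrals of compactly supported functions of mean zero. -/
lemma abs_integral_truncInv_le_of_mean_zero {g : ℝ → ℝ} {B R : ℝ} (hg : Integrable g)
    (hR : 0 < R) (hsupp : ∀ x, R < |x| → g x = 0) (hB : ∀ x, |g x| ≤ B) (hmean : ∫ x, g x = 0)
    {x δ : ℝ} (hx : 2 * R ≤ |x|) (hδ : 0 < δ) (hδR : δ < R) :
    |∫ r, g (x - r) * truncInv δ r| ≤ 4 * R ^ 2 * B / x ^ 2 := by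
  have hx0 : 0 < |x| := by linarith
  have hB0 : 0 ≤ B := (abs_nonneg _).trans (hB 0)
  have h1 : Integrable fun r => g (x - r) * truncInv δ r :=
    integrable_mul_truncInv (hg.comp_sub_left x) hδ
  have h2 : Integrable fun r => g (x - r) * (1 / x) := (hg.comp_sub_left x).mul_const _
  have h3 : ∫ r, g (x - r) * truncInv δ r =
      ∫ r, (g (x - r) * truncInv δ r - g (x - r) * (1 / x)) := by
    rw [integral_sub h1 h2, integral_mul_const, integral_sub_left_eq_self g volume x, hmean]
    simp
  have h5 : ‖∫ r, (g (x - r) * truncInv δ r - g (x - r) * (1 / x))‖ ≤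
      ∫ r, (Set.Icc (x - R) (x + R)).indicator (fun _ => B * (2 * R / x ^ 2)) r := by
    refine norm_integral_le_of_norm_le (integrable_indicator_Icc_const _ _ _)
      (ae_of_all _ fun r => ?_)
    · rw [← mul_sub, Real.norm_eq_abs, abs_mul, Set.indicator_apply]
      have hmem : r ∈ Set.Icc (x - R) (x + R) ↔ |x - r| ≤ R := by
        rw [Set.mem_Icc, abs_le]
        constructor <;> rintro ⟨_, _⟩ <;> constructor <;> linarith
      split_ifs with h
      · rw [hmem] at h
        have hr : |x| / 2 ≤ |r| := by
          have := abs_sub_abs_le_abs_sub x r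
          linarith
        have hr0 : 0 < |r| := by linarith
        have hk : truncInv δ r = 1 / r := if_pos (by linarith)
        have hd : 1 / r - 1 / x = (x - r) / (r * x) := by
          have : r ≠ 0 := abs_pos.1 hr0
          have : x ≠ 0 := abs_pos.1 hx0
          field_simp
        rw [hk, hd, abs_div, abs_mul]
        have : |x - r| / (|r| * |x|) ≤ R / (|x| / 2 * |x|) := by gcongr
        calc |g (x - r)| * (|x - r| / (|r| * |x|)) ≤ B * (R / (|x| / 2 * |x|)) := by
              gcongr
              exact hB _
          _ = B * (2 * R / x ^ 2) := by
              rw [← sq_abs x]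
              field_simp
      · rw [hmem, not_le] at h
        rw [hsupp _ h]
        simp
  rw [← h3, integral_indicator measurableSet_Icc, setIntegral_const,
    Real.volume_real_Icc_of_le (by linarith), smul_eq_mul, Real.norm_eq_abs] at h5
  refine h5.trans (le_of_eq ?_)
  ring

/-- A function with an essentially bounded derivative that exists everywhere is Lipschitz. -/
lemma abs_sub_le_of_ae_abs_deriv_le {g : ℝ → ℝ} {M : ℝ} (hg : ∀ x, DifferentiableAt ℝ g x)
    (hM : ∀ᵐ x : ℝ, |deriv g x| ≤ M) (x y : ℝ) : |g x - g y| ≤ M * |x - y| := by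
  have hint : IntervalIntegrable (deriv g) volume y x := by
    refine (intervalIntegrable_const (c := M)).mono_fun (measurable_deriv g).aestronglyMeasurable
      (ae_restrict_of_ae ?_)
    filter_upwards [hM] with s hs
    exact hs.trans (le_abs_self M)
  rw [← intervalIntegral.integral_eq_sub_of_hasDerivAt (fun s _ => (hg s).hasDerivAt) hint]
  refine intervalIntegral.norm_integral_le_of_norm_le_const_ae (f := deriv g) ?_
  filter_upwards [hM] with s hs _ using hs

lemma HasCompactSupport.exists_eq_zero_of_lt_abs {f : ℝ → ℝ} (hf : HasCompactSupport f) :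
    ∃ R : ℝ, ∀ x, R < |x| → f x = 0 := by
  obtain ⟨R, hR⟩ := hf.isCompact.isBounded.subset_closedBall 0
  refine ⟨R, fun x hx => by_contra fun h => ?_⟩
  have := hR (subset_tsupport f h)
  rw [mem_closedBall_zero_iff, Real.norm_eq_abs] at this
  linarith

lemma mem_Icc_ceil_floor {u R : ℝ} {j : ℤ} :
    j ∈ Finset.Icc ⌈u - R⌉ ⌊u + R⌋ ↔ |u - j| ≤ R := by
  rw [Finset.mem_Icc, Int.ceil_le, Int.le_floor, abs_le]
  constructor <;> rintro ⟨_, _⟩ <;> constructor <;> linarith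

lemma sum_abs_le_of_eq_zero {f : ℤ → ℝ} {u R B : ℝ} (hR : 0 ≤ R)
    (hB : ∀ j, |f j| ≤ B) (hf : ∀ j : ℤ, R < |u - j| → f j = 0) (s : Finset ℤ) :
    ∑ j ∈ s, |f j| ≤ (2 * R + 1) * B := by
  have hB0 : 0 ≤ B := (abs_nonneg _).trans (hB 0)
  set t := Finset.Icc ⌈u - R⌉ ⌊u + R⌋ with ht
  have hcard : (t.card : ℝ) ≤ 2 * R + 1 := by
    rw [ht, Int.card_Icc]
    have h1 := Int.le_ceil (u - R)
    have h2 := Int.floor_le (u + R)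
    have h3 : (((⌊u + R⌋ + 1 - ⌈u - R⌉).toNat : ℤ) : ℝ) ≤ 2 * R + 1 := by
      rw [Int.toNat_eq_max, Int.cast_max]
      push_cast
      exact max_le (by linarith) (by linarith)
    exact_mod_cast h3
  calc ∑ j ∈ s, |f j| ≤ ∑ j ∈ s ∪ t, |f j| :=
        Finset.sum_le_sum_of_subset_of_nonneg Finset.subset_union_left
          fun _ _ _ => abs_nonneg _
    _ = ∑ j ∈ t, |f j| := by
        refine (Finset.sum_subset Finset.subset_union_right fun j _ hj => ?_).symm
        rw [ht, mem_Icc_ceil_floor, not_le] at hj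
        rw [hf j hj, abs_zero]
    _ ≤ t.card • B := Finset.sum_le_card_nsmul _ _ _ fun j _ => hB j
    _ ≤ (2 * R + 1) * B := by
        rw [nsmul_eq_mul]
        gcongr

lemma abs_tsum_le_of_eq_zero {f : ℤ → ℝ} {u R B : ℝ} (hR : 0 ≤ R)
    (hB : ∀ j, |f j| ≤ B) (hf : ∀ j : ℤ, R < |u - j| → f j = 0) :
    |∑' j, f j| ≤ (2 * R + 1) * B := by
  rw [tsum_eq_sum (s := Finset.Icc ⌈u - R⌉ ⌊u + R⌋) fun j hj => hf j (by
    rwa [mem_Icc_ceil_floor, not_le] at hj)]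
  exact (Finset.abs_sum_le_sum_abs _ _).trans (sum_abs_le_of_eq_zero hR hB hf _)

lemma summable_const_div_one_add_sq (C q : ℝ) :
    Summable fun j : ℤ => C / (1 + (q - j) ^ 2) := by
  have h := ((Real.summable_one_div_int_add_rpow (-q) 2).2 one_lt_two).mul_left |C|
  refine h.of_norm_bounded_eventually ?_
  refine Set.Finite.subset (Set.finite_singleton ⌊q⌋) fun j hj => ?_
  by_contra hne
  refine hj ?_
  have hx : q - j ≠ 0 := by
    intro h0
    refine hne ?_
    have : q = j := by linarith
    simp [this]
  have hpos : 0 < |(j : ℝ) + -q| := abs_pos.2 fun h0 => hx (by linarith)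
  change ‖C / (1 + (q - j) ^ 2)‖ ≤ |C| * (1 / |(j : ℝ) + -q| ^ (2 : ℝ))
  rw [norm_div, Real.norm_eq_abs, Real.norm_eq_abs,
    abs_of_pos (by positivity : 0 < 1 + (q - j) ^ 2), div_eq_mul_one_div]
  gcongr
  rw [Real.rpow_two, sq_abs]
  nlinarith

section PartialSums

variable {ik : ℝ → ℝ} {R : ℝ}

lemma sum_deriv_translates_eq_zero_of_lt (hd : ∀ p, DifferentiableAt ℝ ik p)
    (hsupp : ∀ x, R < |x| → ik x = 0) (hexact : ∀ u : ℝ, ∑' j : ℤ, ik (u - j) = 1)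
    {N : ℕ} {u : ℝ} (hu : |u| < N - R) :
    ∑ j ∈ Finset.Icc (-N : ℤ) N, deriv ik (u - j) = 0 := by
  have h1 : HasDerivAt (fun v => ∑ j ∈ Finset.Icc (-N : ℤ) N, ik (v - j))
      (∑ j ∈ Finset.Icc (-N : ℤ) N, deriv ik (u - j)) u :=
    HasDerivAt.fun_sum fun j _ => (hd _).hasDerivAt.comp_sub_const u (j : ℝ)
  have h2 : (fun v => ∑ j ∈ Finset.Icc (-N : ℤ) N, ik (v - j)) =ᶠ[𝓝 u] fun _ => 1 := by
    filter_upwards [(isOpen_lt continuous_abs continuous_const).mem_nhds hu] with v hv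
    rw [← hexact v, tsum_eq_sum]
    intro j hj
    apply hsupp
    rw [Finset.mem_Icc, ← abs_le, not_le] at hj
    have hj' : (N : ℝ) < |(j : ℝ)| := by exact_mod_cast hj
    have := abs_sub_abs_le_abs_sub (j : ℝ) v
    rw [abs_sub_comm] at this
    have hv' : |v| < N - R := hv
    linarith
  exact (h1.congr_of_eventuallyEq h2.symm).unique (hasDerivAt_const u 1)

lemma sum_translates_eq_zero_of_lt {g : ℝ → ℝ} (hsupp : ∀ x, R < |x| → g x = 0)
    {N : ℕ} {u : ℝ} (hu : N + R < |u|) :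
    ∑ j ∈ Finset.Icc (-N : ℤ) N, g (u - j) = 0 := by
  refine Finset.sum_eq_zero fun j hj => hsupp _ ?_
  rw [Finset.mem_Icc, ← abs_le] at hj
  have hj' : |(j : ℝ)| ≤ N := by exact_mod_cast hj
  have := abs_sub_abs_le_abs_sub u j
  linarith

end PartialSums

/-- Truncated Hilbert integrals of a bounded function living on the annulus
`N - R ≤ |u| ≤ N + R`. -/
lemma abs_integral_truncInv_le_of_annulus {S : ℝ → ℝ} {N R K q δ : ℝ} (hR : 0 ≤ R)
    (hK : ∀ u, |S u| ≤ K) (hin : ∀ u, |u| < N - R → S u = 0) (hout : ∀ u, N + R < |u| → S u = 0)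
    (hq : R + |q| < N) :
    |∫ r, S (q - r) * truncInv δ r| ≤ 4 * R * K / (N - R - |q|) := by
  have hK0 : 0 ≤ K := (abs_nonneg _).trans (hK 0)
  have hd : 0 < N - R - |q| := by linarith
  set c := K * (1 / (N - R - |q|)) with hc
  have hc0 : 0 ≤ c := by positivity
  rw [← integral_sub_left_eq_self (fun r => S (q - r) * truncInv δ r) volume q]
  simp only [sub_sub_cancel]
  have hi := fun a b : ℝ => integrable_indicator_Icc_const a b c
  have h5 : ‖∫ u, S u * truncInv δ (q - u)‖ ≤
      ∫ u, ((Set.Icc (N - R) (N + R)).indicator (fun _ => c) u +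
        (Set.Icc (-N - R) (-N + R)).indicator (fun _ => c) u) := by
    refine norm_integral_le_of_norm_le ((hi _ _).add (hi _ _)) (ae_of_all _ fun u => ?_)
    have n1 : 0 ≤ (Set.Icc (N - R) (N + R)).indicator (fun _ => c) u :=
      Set.indicator_nonneg (fun _ _ => hc0) u
    have n2 : 0 ≤ (Set.Icc (-N - R) (-N + R)).indicator (fun _ => c) u :=
      Set.indicator_nonneg (fun _ _ => hc0) u
    rw [Real.norm_eq_abs, abs_mul]
    by_cases ha : |u| < N - R
    · rw [hin u ha]
      simpa using add_nonneg n1 n2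
    by_cases hb : N + R < |u|
    · rw [hout u hb]
      simpa using add_nonneg n1 n2
    push Not at ha hb
    have hle : |S u| * |truncInv δ (q - u)| ≤ c := by
      rw [hc]
      gcongr
      · exact hK u
      · refine (abs_truncInv_le _).trans (one_div_le_one_div_of_le hd ?_)
        have := abs_sub_abs_le_abs_sub u q
        rw [abs_sub_comm] at this
        linarith
    rcases abs_cases u with ⟨hu, _⟩ | ⟨hu, _⟩
    · rw [hu] at ha hb
      rw [Set.indicator_of_mem (show u ∈ Set.Icc (N - R) (N + R) from ⟨ha, hb⟩)]
      linarith
    · rw [hu] at ha hb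
      rw [Set.indicator_of_mem
        (show u ∈ Set.Icc (-N - R) (-N + R) from ⟨by linarith, by linarith⟩)]
      linarith
  rw [integral_add (hi _ _) (hi _ _), integral_indicator measurableSet_Icc,
    integral_indicator measurableSet_Icc, setIntegral_const, setIntegral_const,
    Real.volume_real_Icc_of_le (by linarith), Real.volume_real_Icc_of_le (by linarith),
    smul_eq_mul, smul_eq_mul, Real.norm_eq_abs] at h5
  refine h5.trans (le_of_eq ?_)
  rw [hc]
  ring

/-- The integer translates of a function with quadratic decay whose symmetric partial sums have
vanishing truncated Hilbert integrals in the limit sum up to zero. -/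
lemma tsum_hilbert_translates_eq_zero {g H : ℝ → ℝ} {R K : ℝ} (hg : Integrable g) (hR : 0 ≤ R)
    (hH : ∀ x, Tendsto (fun δ => ∫ r, g (x - r) * truncInv δ r) (𝓝[>] 0) (𝓝 (H x)))
    (hK : ∀ (N : ℕ) (u : ℝ), |∑ j ∈ Finset.Icc (-N : ℤ) N, g (u - j)| ≤ K)
    (hin : ∀ (N : ℕ) (u : ℝ), |u| < N - R → ∑ j ∈ Finset.Icc (-N : ℤ) N, g (u - j) = 0)
    (hout : ∀ (N : ℕ) (u : ℝ), N + R < |u| → ∑ j ∈ Finset.Icc (-N : ℤ) N, g (u - j) = 0)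
    (q : ℝ) (hsum : Summable fun j : ℤ => H (q - j)) :
    ∑' j : ℤ, H (q - j) = 0 := by
  have hbound : ∀ᶠ N : ℕ in atTop,
      ‖∑ j ∈ Finset.Icc (-N : ℤ) N, H (q - j)‖ ≤ 4 * R * K / (N - R - |q|) := by
    filter_upwards [tendsto_natCast_atTop_atTop.eventually_gt_atTop (R + |q|)] with N hN
    have hlim : Tendsto (fun δ => ∫ r, (∑ j ∈ Finset.Icc (-N : ℤ) N, g (q - r - j)) * truncInv δ r)
        (𝓝[>] 0) (𝓝 (∑ j ∈ Finset.Icc (-N : ℤ) N, H (q - j))) := by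
      refine (tendsto_finsetSum _ fun (j : ℤ) _ => hH (q - j)).congr' ?_
      filter_upwards [self_mem_nhdsWithin] with δ hδ
      rw [← integral_finsetSum _ fun j _ => integrable_mul_truncInv (hg.comp_sub_left _) hδ]
      simp only [Finset.sum_mul, sub_right_comm]
    exact le_of_tendsto hlim.norm (Eventually.of_forall fun δ =>
      abs_integral_truncInv_le_of_annulus (S := fun u => ∑ j ∈ Finset.Icc (-N : ℤ) N, g (u - j))
        hR (hK N) (hin N) (hout N) hN)
  have hzero : Tendsto (fun N : ℕ => 4 * R * K / ((N : ℝ) - R - |q|)) atTop (𝓝 0) := by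
    refine Tendsto.const_div_atTop ?_ _
    simp only [sub_sub]
    exact tendsto_atTop_add_const_right _ (-(R + |q|)) tendsto_natCast_atTop_atTop
  have h0 : Tendsto (fun N : ℕ => ∑ j ∈ Finset.Icc (-N : ℤ) N, H (q - j)) atTop (𝓝 0) :=
    squeeze_zero_norm' hbound hzero
  exact tendsto_nhds_unique (hsum.hasSum.comp Finset.tendsto_Icc_neg) h0

/-- the function `ψ(q,t) = Σ_{j∈ℤ} (𝓗 ik')(q−j) w(j−q−t)` is
1-periodic in `q`, satisfies `|ψ(q,t)| ≤ C/(1+t²)`, and `∫_ℝ ψ(q,t) dt = 0`. -/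
theorem stmt_10 (w ik Hikp : ℝ → ℝ)
    -- the detector aperture function w ∈ C₀²(ℝ), even, with ∫ w = 1
    (hw_even : ∀ p : ℝ, w (-p) = w p)
    (hw_supp : HasCompactSupport w)
    (hw_d1 : ∀ p : ℝ, DifferentiableAt ℝ w p)
    (hw_d2 : ∀ p : ℝ, DifferentiableAt ℝ (deriv w) p)
    (hw_bdd : ∃ M : ℝ, ∀ᵐ p : ℝ, |deriv (deriv w) p| ≤ M)
    (hw_int : ∫ p : ℝ, w p = 1)
    -- the interpolation kernel ik ∈ C₀²(ℝ), even, exact up to order 1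
    (hik_even : ∀ p : ℝ, ik (-p) = ik p)
    (hik_supp : HasCompactSupport ik)
    (hik_d1 : ∀ p : ℝ, DifferentiableAt ℝ ik p)
    (hik_d2 : ∀ p : ℝ, DifferentiableAt ℝ (deriv ik) p)
    (hik_bdd : ∃ M : ℝ, ∀ᵐ p : ℝ, |deriv (deriv ik) p| ≤ M)
    (hik_exact0 : ∀ u : ℝ, ∑' j : ℤ, ik (u - (j : ℝ)) = 1)
    (hik_exact1 : ∀ u : ℝ, ∑' j : ℤ, (j : ℝ) * ik (u - (j : ℝ)) = u)
    -- Hikp is the Hilbert transform of ik'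
    (hHikp : ∀ t : ℝ, Tendsto
      (fun δ : ℝ => ∫ s in {s : ℝ | δ < |t - s|}, deriv ik s / (t - s))
      (𝓝[>] (0:ℝ)) (𝓝 (Real.pi * Hikp t)))
    -- ψ
    (ψ : ℝ → ℝ → ℝ)
    (hψ : ∀ q t : ℝ, ψ q t = ∑' j : ℤ, Hikp (q - (j : ℝ)) * w ((j : ℝ) - q - t)) :
    (∀ q t : ℝ, ψ (q + 1) t = ψ q t) ∧
    (∃ C : ℝ, 0 < C ∧ ∀ q t : ℝ, |ψ q t| ≤ C / (1 + t ^ 2)) ∧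
    (∀ q : ℝ, ∫ t : ℝ, ψ q t = 0) := by
  set g := deriv ik with hgdef
  have hg_cont : Continuous g := continuous_iff_continuousAt.2 fun p => (hik_d2 p).continuousAt
  have hw_cont : Continuous w := continuous_iff_continuousAt.2 fun p => (hw_d1 p).continuousAt
  have hg_cs : HasCompactSupport g := hik_supp.deriv
  have hg_int : Integrable g := hg_cont.integrable_of_hasCompactSupport hg_cs
  have hw_integrable : Integrable w := hw_cont.integrable_of_hasCompactSupport hw_supp
  obtain ⟨B, hB⟩ := hg_cont.bounded_above_of_compact_support hg_cs
  obtain ⟨W, hW⟩ := hw_cont.bounded_above_of_compact_support hw_supp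
  obtain ⟨L, hL⟩ := hik_bdd
  have hLip := abs_sub_le_of_ae_abs_deriv_le hik_d2 hL
  obtain ⟨R, hR1, hRw, hRik, hRg⟩ : ∃ R : ℝ, 1 ≤ R ∧ (∀ x, R < |x| → w x = 0) ∧
      (∀ x, R < |x| → ik x = 0) ∧ ∀ x, R < |x| → g x = 0 := by
    obtain ⟨R₁, h₁⟩ := hw_supp.exists_eq_zero_of_lt_abs
    obtain ⟨R₂, h₂⟩ := hik_supp.exists_eq_zero_of_lt_abs
    obtain ⟨R₃, h₃⟩ := hg_cs.exists_eq_zero_of_lt_abs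
    refine ⟨max 1 (max R₁ (max R₂ R₃)), le_max_left _ _, fun x hx => h₁ x ?_,
      fun x hx => h₂ x ?_, fun x hx => h₃ x ?_⟩ <;> simp only [max_lt_iff] at hx <;> tauto
  have hR0 : 0 < R := by linarith
  have hmean : ∫ x, g x = 0 := by
    have hodd : ∀ x, g (-x) = -g x := fun x => by
      have h := deriv_comp_neg ik x
      simp only [hik_even] at h
      rw [hgdef, h, neg_neg]
    have h := integral_neg_eq_self g volume
    simp only [hodd, integral_neg] at h
    linarith
  have hlim : ∀ x, Tendsto (fun δ => ∫ r, g (x - r) * truncInv δ r) (𝓝[>] 0)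
      (𝓝 (Real.pi * Hikp x)) := fun x =>
    (hHikp x).congr fun δ => setIntegral_div_eq_integral_truncInv g x δ
  have hπ : 1 ≤ Real.pi := by linarith [Real.pi_gt_three]
  have habs : ∀ x, |Hikp x| ≤ |Real.pi * Hikp x| := fun x => by
    rw [abs_mul, abs_of_pos Real.pi_pos]
    exact le_mul_of_one_le_left (abs_nonneg _) hπ
  have hB0 : 0 ≤ B := (norm_nonneg _).trans (hB 0)
  have hW0 : 0 ≤ W := (norm_nonneg _).trans (hW 0)
  have hL0 : 0 ≤ L := by simpa using (abs_nonneg _).trans (hLip 1 0)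
  obtain ⟨C, hC0, hC⟩ : ∃ C : ℝ, 0 < C ∧ ∀ x, |Hikp x| ≤ C / (1 + x ^ 2) := by
    refine ⟨6 * L * R * (1 + 4 * R ^ 2) + 8 * R ^ 2 * B + 1, by positivity, fun x => ?_⟩
    rw [le_div_iff₀ (by positivity)]
    rcases le_total (2 * R) |x| with hx | hx
    · have h1 : |Real.pi * Hikp x| ≤ 4 * R ^ 2 * B / x ^ 2 := by
        refine le_of_tendsto (hlim x).abs ?_
        filter_upwards [Ioo_mem_nhdsGT hR0] with δ hδ
        exact abs_integral_truncInv_le_of_mean_zero hg_int hR0 hRg hB hmean hx hδ.1 hδ.2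
      have hx1 : 1 ≤ x ^ 2 := by
        rw [← sq_abs]
        nlinarith
      calc |Hikp x| * (1 + x ^ 2) ≤ 4 * R ^ 2 * B / x ^ 2 * (x ^ 2 + x ^ 2) := by
            gcongr
            exact (habs x).trans h1
        _ = 8 * R ^ 2 * B := by
            have : x ^ 2 ≠ 0 := by positivity
            rw [← two_mul, mul_left_comm, div_mul_cancel₀ _ this]
            ring
        _ ≤ _ := by
            have : 0 ≤ 6 * L * R * (1 + 4 * R ^ 2) := by positivity
            linarith
    · have h1 : |Real.pi * Hikp x| ≤ 2 * L * (|x| + R) := by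
        refine le_of_tendsto (hlim x).abs ?_
        filter_upwards [self_mem_nhdsWithin] with δ hδ
        exact abs_integral_truncInv_le_of_lipschitz hg_int hR0.le hRg hLip x hδ
      have hx2 : x ^ 2 ≤ 4 * R ^ 2 := by
        rw [← sq_abs]
        nlinarith [abs_nonneg x]
      calc |Hikp x| * (1 + x ^ 2) ≤ 2 * L * (2 * R + R) * (1 + 4 * R ^ 2) := by
            gcongr
            exact (habs x).trans (h1.trans (by gcongr))
        _ = 6 * L * R * (1 + 4 * R ^ 2) := by ring
        _ ≤ _ := by
            have : 0 ≤ 8 * R ^ 2 * B := by positivity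
            linarith
  have hsumH : ∀ q, Summable fun j : ℤ => Hikp (q - j) := fun q =>
    (summable_const_div_one_add_sq C q).of_norm_bounded fun j => hC _
  have hzero : ∀ q, ∑' j : ℤ, Hikp (q - j) = 0 := fun q => by
    have h := tsum_hilbert_translates_eq_zero (K := (2 * R + 1) * B) hg_int hR0.le hlim
      (fun N u => (Finset.abs_sum_le_sum_abs _ _).trans
        (sum_abs_le_of_eq_zero (u := u) hR0.le (fun j => hB _) (fun j hj => hRg _ hj) _))
      (fun N u hu => sum_deriv_translates_eq_zero_of_lt hik_d1 hRik hik_exact0 hu)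
      (fun N u hu => sum_translates_eq_zero_of_lt hRg hu) q ((hsumH q).mul_left _)
    rw [tsum_mul_left] at h
    exact (mul_eq_zero.1 h).resolve_left Real.pi_ne_zero
  refine ⟨fun q t => ?_, ⟨(2 * R + 1) * (C * (2 * (1 + R ^ 2)) * (W + 1)), by positivity,
    fun q t => ?_⟩, fun q => ?_⟩
  · rw [hψ, hψ, ← (Equiv.addRight (1 : ℤ)).tsum_eq]
    refine tsum_congr fun j => ?_
    rw [Equiv.coe_addRight]
    push_cast
    congr 2 <;> ring
  · rw [hψ, mul_div_assoc]
    refine abs_tsum_le_of_eq_zero (u := q + t) hR0.le (fun j => ?_) fun j hj => ?_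
    · rcases lt_or_ge R |(j : ℝ) - q - t| with hj | hj
      · rw [hRw _ hj, mul_zero, abs_zero]
        positivity
      · rw [abs_mul, div_eq_mul_inv, mul_right_comm]
        have hy : ((j : ℝ) - q - t) ^ 2 ≤ R ^ 2 := by
          rw [← sq_abs]
          gcongr
        have hpeetre : C / (1 + (q - j) ^ 2) ≤ C * (2 * (1 + R ^ 2)) * (1 + t ^ 2)⁻¹ := by
          rw [← div_eq_mul_inv, div_le_div_iff₀ (by positivity) (by positivity), mul_assoc]
          gcongr
          have h1 : 1 + t ^ 2 ≤ 2 * (1 + ((j : ℝ) - q - t) ^ 2) * (1 + (q - j) ^ 2) := by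
            nlinarith [sq_nonneg ((q - j) - ((j : ℝ) - q - t)), sq_nonneg (q - (j : ℝ)),
              sq_nonneg ((j : ℝ) - q - t), sq_nonneg ((q - j) * ((j : ℝ) - q - t))]
          refine h1.trans ?_
          gcongr
        have hw1 : |w ((j : ℝ) - q - t)| ≤ W + 1 := (hW _).trans (by linarith)
        gcongr
        exact (hC _).trans hpeetre
    · rw [hRw _ (by rwa [abs_sub_comm, ← sub_sub] at hj), mul_zero]
  · have hcomp : ∀ j : ℤ, Integrable fun t => Hikp (q - j) * w ((j : ℝ) - q - t) := fun j =>
      (hw_integrable.comp_sub_left _).const_mul _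
    have hnorm : Summable fun j : ℤ => ∫ t, ‖Hikp (q - j) * w ((j : ℝ) - q - t)‖ := by
      have h : ∀ j : ℤ, ∫ t, ‖Hikp (q - j) * w ((j : ℝ) - q - t)‖ =
          ‖Hikp (q - j)‖ * ∫ t, ‖w t‖ := fun j => by
        simp only [norm_mul]
        rw [integral_const_mul, integral_sub_left_eq_self (fun t => ‖w t‖) volume]
      simp only [h]
      exact (hsumH q).norm.mul_right _
    simp only [hψ]
    rw [← integral_tsum_of_summable_integral_norm hcomp hnorm]
    simp only [integral_const_mul, integral_sub_left_eq_self w volume, hw_int, mul_one]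
    exact hzero q
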